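/- There exists an undirected graph G and an integral vector x that is a 2-strongly-connected orientation vector of G (x ≥ 0, x_{e⁺}+x_{e⁻}=2 for every edge, x(δ⁺(U)) ≥ 2 for every nonempty proper U) which cannot be written as the sum of the characteristic vectors of two strongly connected orientations of G. -/

import Mathlib

open Finset

variable {V E : Type*} [Fintype V] [DecidableEq V] [Fintype E] [DecidableEq E]

/-- The arcs leaving the vertex set `U` (generic in the arc type). -/
def outArcs {A : Type*} [Fintype A] (src tgt : A → V) (U : Finset V) : Finset A :=
  univ.filter fun a => src a ∈ U ∧ tgt a ∉ U

/-- Source of an arc of the bidirected graph `E × Bool`: `(e, true) = e⁺` goes from `s e` to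
`t e`, and `(e, false) = e⁻` goes from `t e` to `s e`. -/
def bsrc (s t : E → V) (p : E × Bool) : V := if p.2 then s p.1 else t p.1

/-- Target of an arc of the bidirected graph `E × Bool`. -/
def btgt (s t : E → V) (p : E × Bool) : V := if p.2 then t p.1 else s p.1

/-- A strongly connected orientation of the graph with edges `E` and endpoints `s`, `t`:
a choice `O` of one direction per edge such that every nonempty proper cut has a leaving arc. -/
def IsSCO (s t : E → V) (O : E → Bool) : Prop :=
  ∀ U : Finset V, U.Nonempty → U ≠ univ →
    ∃ e : E, (e, O e) ∈ outArcs (bsrc s t) (btgt s t) U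

theorem mem_outArcs {V A : Type*} [DecidableEq V] [Fintype A] {src tgt : A → V} {U : Finset V}
    {a : A} : a ∈ outArcs src tgt U ↔ src a ∈ U ∧ tgt a ∉ U := by
  simp [outArcs]

namespace SchrijverGraph

/-- Tails of the reference directions: edges `0, …, 8` form three paths with three edges each,
edges `9, …, 20` are the arcs that are fixed in their reference direction. -/
def tail : Fin 21 → Fin 12 :=
  ![0, 1, 2, 4, 5, 6, 8, 9, 10, 0, 2, 2, 3, 4, 5, 5, 7, 8, 10, 10, 11]

/-- Heads of the reference directions. -/
def head : Fin 21 → Fin 12 :=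
  ![1, 2, 3, 5, 6, 7, 9, 10, 11, 6, 4, 8, 9, 1, 0, 11, 9, 1, 3, 7, 6]

/-- The orientation vector: `1` in both directions on the paths, `2` on the fixed arcs and
`0` on their reversals. -/
def weight (p : Fin 21 × Bool) : ℤ := if p.1 < 9 then 1 else if p.2 then 2 else 0

theorem sum_weight_outArcs (U : Finset (Fin 12)) :
    ∑ p ∈ outArcs (bsrc tail head) (btgt tail head) U, weight p =
      ((∑ e : Fin 21, if e < 9 then (decide (tail e ∈ U) ^^ decide (head e ∈ U)).toNat
        else 2 * (decide (tail e ∈ U) && !decide (head e ∈ U)).toNat : ℕ) : ℤ) := by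
  rw [outArcs, Finset.sum_filter, Fintype.sum_prod_type, Nat.cast_sum]
  refine Finset.sum_congr rfl fun e _ => ?_
  simp only [Fintype.sum_bool, bsrc, btgt, weight]
  by_cases h₁ : tail e ∈ U <;> by_cases h₂ : head e ∈ U <;> by_cases h₃ : e < 9 <;>
    simp [h₁, h₂, h₃]

/-- The cut condition, for the vertex set with indicator `b₀, …, b₁₁`. -/
theorem two_le_cut : ∀ b₀ b₁ b₂ b₃ b₄ b₅ b₆ b₇ b₈ b₉ b₁₀ b₁₁ : Bool,
    ((b₀ && b₁ && b₂ && b₃ && b₄ && b₅ && b₆ && b₇ && b₈ && b₉ && b₁₀ && b₁₁) ||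
      !(b₀ || b₁ || b₂ || b₃ || b₄ || b₅ || b₆ || b₇ || b₈ || b₉ || b₁₀ || b₁₁) ||
      Nat.ble 2 ((b₀ ^^ b₁).toNat + (b₁ ^^ b₂).toNat + (b₂ ^^ b₃).toNat +
        (b₄ ^^ b₅).toNat + (b₅ ^^ b₆).toNat + (b₆ ^^ b₇).toNat +
        (b₈ ^^ b₉).toNat + (b₉ ^^ b₁₀).toNat + (b₁₀ ^^ b₁₁).toNat +
        2 * (b₀ && !b₆).toNat + 2 * (b₂ && !b₄).toNat + 2 * (b₂ && !b₈).toNat +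
        2 * (b₃ && !b₉).toNat + 2 * (b₄ && !b₁).toNat + 2 * (b₅ && !b₀).toNat +
        2 * (b₅ && !b₁₁).toNat + 2 * (b₇ && !b₉).toNat + 2 * (b₈ && !b₁).toNat +
        2 * (b₁₀ && !b₃).toNat + 2 * (b₁₀ && !b₇).toNat + 2 * (b₁₁ && !b₆).toNat)) = true := by
  decide +kernel

theorem two_le_sum_weight (U : Finset (Fin 12)) (hU : U.Nonempty) (hU' : U ≠ univ) :
    2 ≤ ∑ p ∈ outArcs (bsrc tail head) (btgt tail head) U, weight p := by
  have key := two_le_cut (decide (0 ∈ U)) (decide (1 ∈ U)) (decide (2 ∈ U)) (decide (3 ∈ U))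
    (decide (4 ∈ U)) (decide (5 ∈ U)) (decide (6 ∈ U)) (decide (7 ∈ U)) (decide (8 ∈ U))
    (decide (9 ∈ U)) (decide (10 ∈ U)) (decide (11 ∈ U))
  rw [Bool.or_eq_true, Bool.or_eq_true] at key
  rcases key with (h | h) | h
  · refine absurd (Finset.eq_univ_iff_forall.2 fun i => ?_) hU'
    simp only [Bool.and_eq_true, decide_eq_true_eq] at h
    fin_cases i <;> simp [h]
  · obtain ⟨i, hi⟩ := hU
    simp only [Bool.not_eq_true', Bool.or_eq_false_iff, decide_eq_false_iff_not] at h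
    fin_cases i <;> simp [h] at hi
  · rw [sum_weight_outArcs]
    refine (Nat.cast_le (α := ℤ)).2 ((Nat.le_of_ble_eq_true h).trans_eq ?_)
    simp only [Fin.sum_univ_castSucc, Fin.sum_univ_zero, zero_add]
    rfl

/-- If two strongly connected orientations sum up to `weight`, then along every cut without a
leaving fixed arc the first one traverses path edges in both directions. -/
theorem exists_leaving_and_entering {O₁ O₂ : Fin 21 → Bool}
    (h₁ : IsSCO tail head O₁) (h₂ : IsSCO tail head O₂)
    (hx : ∀ p : Fin 21 × Bool, weight p =
      (if O₁ p.1 = p.2 then (1 : ℤ) else 0) + (if O₂ p.1 = p.2 then (1 : ℤ) else 0))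
    (U : Finset (Fin 12)) (hU : U.Nonempty) (hU' : U ≠ univ)
    (hF : ∀ e : Fin 21, 9 ≤ e → tail e ∈ U → head e ∈ U) :
    (∃ e : Fin 21, e < 9 ∧ (tail e ∈ U ↔ O₁ e = true) ∧ (head e ∈ U ↔ O₁ e = false)) ∧
      ∃ e : Fin 21, e < 9 ∧ (tail e ∈ U ↔ O₁ e = false) ∧ (head e ∈ U ↔ O₁ e = true) := by
  constructor
  · obtain ⟨e, he⟩ := h₁ U hU hU'
    refine ⟨e, ?_⟩
    replace hx := hx (e, true)
    replace hF := hF e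
    rw [mem_outArcs] at he
    simp only [bsrc, btgt] at he
    by_cases h9 : e < 9 <;> cases h : O₁ e <;> cases h' : O₂ e <;>
      simp_all [weight]
  · obtain ⟨e, he⟩ := h₂ U hU hU'
    refine ⟨e, ?_⟩
    replace hx := hx (e, true)
    replace hF := hF e
    rw [mem_outArcs] at he
    simp only [bsrc, btgt] at he
    by_cases h9 : e < 9 <;> cases h : O₁ e <;> cases h' : O₂ e <;>
      simp_all [weight]

theorem not_exists_sco_add_sco :
    ¬ ∃ O₁ O₂ : Fin 21 → Bool, IsSCO tail head O₁ ∧ IsSCO tail head O₂ ∧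
      ∀ p : Fin 21 × Bool, weight p =
        (if O₁ p.1 = p.2 then (1 : ℤ) else 0) + (if O₂ p.1 = p.2 then (1 : ℤ) else 0) := by
  rintro ⟨O₁, O₂, h₁, h₂, hx⟩
  have key := exists_leaving_and_entering h₁ h₂ hx
  have a₁ := key {1} (by decide) (by decide) (by decide)
  have a₂ := key {2}ᶜ (by decide) (by decide) (by decide)
  have a₃ := key {5}ᶜ (by decide) (by decide) (by decide)
  have a₄ := key {6} (by decide) (by decide) (by decide)
  have a₅ := key {9} (by decide) (by decide) (by decide)
  have a₆ := key {10}ᶜ (by decide) (by decide) (by decide)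
  have a₇ := key {3, 6, 7, 9, 10, 11} (by decide) (by decide) (by decide)
  have a₈ := key {0, 1, 4, 5, 6, 11} (by decide) (by decide) (by decide)
  have a₉ := key {0, 1, 6, 7, 8, 9} (by decide) (by decide) (by decide)
  have a₁₀ := key {1, 2, 3, 4, 8, 9} (by decide) (by decide) (by decide)
  simp [Fin.exists_fin_succ, tail, head] at a₁ a₂ a₃ a₄ a₅ a₆ a₇ a₈ a₉ a₁₀
  grind

end SchrijverGraph

/-- There is an undirected graph `G` (with vertices `Fin n` and edges `Fin m`) and a
`2`-strongly-connected orientation vector `x` of `G` that is not the sum of the characteristic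
vectors of two strongly connected orientations. -/
theorem exists_indecomposable_two_sco :
    ∃ (n m : ℕ) (s t : Fin m → Fin n) (x : Fin m × Bool → ℤ),
      (∀ p, 0 ≤ x p) ∧
      (∀ e : Fin m, x (e, true) + x (e, false) = 2) ∧
      (∀ U : Finset (Fin n), U.Nonempty → U ≠ univ →
        (2 : ℤ) ≤ ∑ p ∈ outArcs (bsrc s t) (btgt s t) U, x p) ∧
      ¬ ∃ O₁ O₂ : Fin m → Bool, IsSCO s t O₁ ∧ IsSCO s t O₂ ∧
          ∀ p : Fin m × Bool,
            x p = (if O₁ p.1 = p.2 then (1 : ℤ) else 0) +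
                  (if O₂ p.1 = p.2 then (1 : ℤ) else 0) := by
  exact ⟨12, 21, SchrijverGraph.tail, SchrijverGraph.head, SchrijverGraph.weight,
    fun p => by unfold SchrijverGraph.weight; split_ifs <;> simp,
    fun e => by unfold SchrijverGraph.weight; split_ifs <;> simp_all,
    SchrijverGraph.two_le_sum_weight, SchrijverGraph.not_exists_sco_add_sco⟩
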